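/- arXiv:1206.5440 — 2 statements merged into one kernel-verified Lean document; each statement's English description precedes it below -/
import Mathlib

section
/- Let n ≥ 2 and let Φ : ℝⁿ → ℂ be a Schwartz function. There is a constant C > 0, depending only on Φ and n, such that for all s ≥ 1, all orthonormal unit vectors e₁, e₂ ∈ ℝⁿ, and every Schwartz function u : ℝⁿ → ℂ: ∫_{ℝⁿ} (1 + ‖ξ‖²)^{1/2} |𝓕(Φu)(ξ)|² dξ ≤ C ∫_{ℝⁿ} (s + |p_ζ(ξ)|) |𝓕u(ξ)|² dξ. (Equivalently, ‖Φu‖_{H^{1/2,2}} ≲ ‖u‖_{X^{1/2}_ζ}.) -/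
open MeasureTheory
open scoped RealInnerProductSpace FourierTransform

/-- The modulus `|p_ζ(ξ)|` of the symbol `p_ζ(ξ) = -‖ξ‖² + 2iζ·ξ` of the conjugated
Laplacian `Δ + 2ζ·∇`, where `ζ = s(e₁ - i e₂)`. -/
noncomputable def pAbs {n : ℕ} (s : ℝ) (e₁ e₂ ξ : EuclideanSpace ℝ (Fin n)) : ℝ :=
  Real.sqrt ((‖ξ‖ ^ 2 - 2 * s * ⟪e₂, ξ⟫) ^ 2 + 4 * s ^ 2 * ⟪e₁, ξ⟫ ^ 2)

open scoped SchwartzMap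

section SobolevMultiplier

variable {E : Type*} [NormedAddCommGroup E]

theorem integral_mul_sq_le {α : Type*} [MeasurableSpace α] {μ : Measure α} {a b : α → ℝ}
    (ha : 0 ≤ a) (h0 : Integrable a μ) (h1 : Integrable (fun t => a t * b t) μ)
    (h2 : Integrable (fun t => a t * b t ^ 2) μ) :
    (∫ t, a t * b t ∂μ) ^ 2 ≤ (∫ t, a t ∂μ) * ∫ t, a t * b t ^ 2 ∂μ := by
  have key : ∀ l : ℝ, 0 ≤ (∫ t, a t ∂μ) * (l * l) + (-2 * ∫ t, a t * b t ∂μ) * l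
      + ∫ t, a t * b t ^ 2 ∂μ := by
    intro l
    have h : 0 ≤ ∫ t, (a t * b t ^ 2 - 2 * l * (a t * b t) + l * l * a t) ∂μ := by
      refine integral_nonneg fun t => ?_
      have := mul_nonneg (ha t) (sq_nonneg (b t - l))
      simp only [Pi.zero_apply]
      linarith
    rw [integral_add (by exact h2.sub (h1.const_mul _)) (h0.const_mul _),
      integral_sub h2 (h1.const_mul _), integral_const_mul, integral_const_mul] at h
    linarith
  have := discrim_le_zero key
  rw [discrim] at this
  linarith

theorem sqrt_one_add_norm_sq_add_le (x y : E) :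
    Real.sqrt (1 + ‖x + y‖ ^ 2) ≤
      2 * (Real.sqrt (1 + ‖x‖ ^ 2) * Real.sqrt (1 + ‖y‖ ^ 2)) := by
  rw [← Real.sqrt_mul (by positivity)]
  refine Real.sqrt_le_iff.2 ⟨by positivity, ?_⟩
  rw [mul_pow, Real.sq_sqrt (by positivity)]
  have h := pow_le_pow_left₀ (norm_nonneg _) (norm_add_le x y) 2
  nlinarith [sq_nonneg (‖x‖ - ‖y‖), sq_nonneg (‖x‖ * ‖y‖), sq_nonneg ‖x‖, sq_nonneg ‖y‖]

theorem sqrt_one_add_norm_sq_le_one_add_sq (x : E) : Real.sqrt (1 + ‖x‖ ^ 2) ≤ 1 + ‖x‖ ^ 2 :=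
  Real.sqrt_le_iff.2 ⟨by positivity, by nlinarith [sq_nonneg ‖x‖]⟩

variable [InnerProductSpace ℝ E]

theorem SchwartzMap.exists_norm_le (f : 𝓢(E, ℂ)) : ∃ M, ∀ x, ‖f x‖ ≤ M :=
  ⟨SchwartzMap.seminorm ℝ 0 0 f, SchwartzMap.norm_le_seminorm ℝ f⟩

variable [FiniteDimensional ℝ E] [MeasurableSpace E] [BorelSpace E]

theorem SchwartzMap.integrable_mul_norm (f : 𝓢(E, ℂ)) {φ : E → ℝ} (hφ : Continuous φ) {K : ℝ}
    (hK : ∀ x, ‖φ x‖ ≤ K * (1 + ‖x‖ ^ 2)) : Integrable (fun x => φ x * ‖f x‖) := by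
  have h : Integrable (fun x => K * (‖x‖ ^ 0 * ‖f x‖ + ‖x‖ ^ 2 * ‖f x‖)) :=
    ((f.integrable_pow_mul volume 0).add (f.integrable_pow_mul volume 2)).const_mul K
  refine h.mono' (hφ.mul f.continuous.norm).aestronglyMeasurable (.of_forall fun x => ?_)
  rw [norm_mul, norm_norm]
  calc _ ≤ K * (1 + ‖x‖ ^ 2) * ‖f x‖ := by gcongr; exact hK x
    _ = _ := by ring

theorem SchwartzMap.integrable_mul_norm_sq (f : 𝓢(E, ℂ)) {φ : E → ℝ} (hφ : Continuous φ) {K : ℝ}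
    (hK : ∀ x, ‖φ x‖ ≤ K * (1 + ‖x‖ ^ 2)) : Integrable (fun x => φ x * ‖f x‖ ^ 2) := by
  obtain ⟨M, hM⟩ := f.exists_norm_le
  have h := (f.integrable_mul_norm hφ hK).mul_bdd (g := fun x => ‖f x‖) (c := M)
    f.continuous.norm.aestronglyMeasurable (.of_forall fun x => by simpa using hM x)
  simpa [mul_assoc, sq] using h

theorem SchwartzMap.fourier_mul_eq_convolution (f g : 𝓢(E, ℂ)) (ξ : E) :
    𝓕 (fun x => f x * g x) ξ = ∫ t, 𝓕 f t * 𝓕 g (ξ - t) := by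
  set B := ContinuousLinearMap.mul ℂ ℂ
  have h : ∀ y, (𝓕⁻ (SchwartzMap.convolution B (𝓕 f) (𝓕 g)) : 𝓢(E, ℂ)) y = f y * g y := by
    intro y
    have hinv : ∀ (k : 𝓢(E, ℂ)), (𝓕⁻ k : 𝓢(E, ℂ)) y = (𝓕 k : 𝓢(E, ℂ)) (-y) := by
      intro k
      rw [SchwartzMap.fourierInv_coe, SchwartzMap.fourier_coe, Real.fourierInv_eq_fourier_neg]
    rw [hinv, SchwartzMap.fourier_convolution, SchwartzMap.pairing_apply_apply, ← hinv, ← hinv]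
    simp [B]
  have h' : (fun x => f x * g x) = ⇑(𝓕⁻ (SchwartzMap.convolution B (𝓕 f) (𝓕 g)) : 𝓢(E, ℂ)) :=
    funext fun y => (h y).symm
  rw [h', ← SchwartzMap.fourier_coe, FourierTransform.fourier_fourierInv_eq,
    SchwartzMap.convolution_apply]
  rfl

theorem SchwartzMap.weight_mul_norm_integral_sq_le (f g : 𝓢(E, ℂ)) (ξ : E) :
    Real.sqrt (1 + ‖ξ‖ ^ 2) * ‖∫ t, f t * g (ξ - t)‖ ^ 2 ≤
      2 * (∫ t, ‖f t‖) * ∫ t, (Real.sqrt (1 + ‖t‖ ^ 2) * ‖f t‖) *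
        (Real.sqrt (1 + ‖ξ - t‖ ^ 2) * ‖g (ξ - t)‖ ^ 2) := by
  obtain ⟨M, hM⟩ := g.exists_norm_le
  have hc : Continuous fun t => ‖g (ξ - t)‖ := by fun_prop
  have h0 : Integrable fun t => ‖f t‖ := f.integrable.norm
  have h1 : Integrable fun t => ‖f t‖ * ‖g (ξ - t)‖ :=
    h0.mul_bdd (c := M) hc.aestronglyMeasurable (.of_forall fun t => by simpa using hM _)
  have h2 : Integrable fun t => ‖f t‖ * ‖g (ξ - t)‖ ^ 2 := by
    simpa [sq, mul_assoc] using
      h1.mul_bdd (c := M) hc.aestronglyMeasurable (.of_forall fun t => by simpa using hM _)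
  have h3 : Integrable fun t => (Real.sqrt (1 + ‖t‖ ^ 2) * ‖f t‖) *
        (Real.sqrt (1 + ‖ξ - t‖ ^ 2) * ‖g (ξ - t)‖ ^ 2) := by
    have hd : Integrable fun t => Real.sqrt (1 + ‖ξ - t‖ ^ 2) * ‖g (ξ - t)‖ ^ 2 :=
      (g.integrable_mul_norm_sq (φ := fun x => Real.sqrt (1 + ‖x‖ ^ 2)) (K := 1) (by fun_prop)
        (fun x => by
          rw [Real.norm_of_nonneg (Real.sqrt_nonneg _), one_mul]
          exact sqrt_one_add_norm_sq_le_one_add_sq x)).comp_sub_left ξ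
    refine hd.bdd_mul (c := SchwartzMap.seminorm ℝ 0 0 f + SchwartzMap.seminorm ℝ 2 0 f)
      (Continuous.aestronglyMeasurable (by fun_prop)) (.of_forall fun t => ?_)
    rw [Real.norm_of_nonneg (by positivity)]
    have ha := SchwartzMap.norm_le_seminorm ℝ f t
    have hb := SchwartzMap.norm_pow_mul_le_seminorm ℝ f 2 t
    have := mul_le_mul_of_nonneg_right (sqrt_one_add_norm_sq_le_one_add_sq t) (norm_nonneg (f t))
    linarith
  have hn : ‖∫ t, f t * g (ξ - t)‖ ≤ ∫ t, ‖f t‖ * ‖g (ξ - t)‖ := by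
    refine (norm_integral_le_integral_norm _).trans_eq ?_
    simp
  calc _ ≤ Real.sqrt (1 + ‖ξ‖ ^ 2) *
          ((∫ t, ‖f t‖) * ∫ t, ‖f t‖ * ‖g (ξ - t)‖ ^ 2) := by
        gcongr
        exact (pow_le_pow_left₀ (norm_nonneg _) hn 2).trans
          (integral_mul_sq_le (fun _ => norm_nonneg _) h0 h1 h2)
    _ = (∫ t, ‖f t‖) * ∫ t, Real.sqrt (1 + ‖ξ‖ ^ 2) * (‖f t‖ * ‖g (ξ - t)‖ ^ 2) := by
        rw [integral_const_mul]; ring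
    _ ≤ (∫ t, ‖f t‖) * ∫ t, 2 * ((Real.sqrt (1 + ‖t‖ ^ 2) * ‖f t‖) *
        (Real.sqrt (1 + ‖ξ - t‖ ^ 2) * ‖g (ξ - t)‖ ^ 2)) := by
        refine mul_le_mul_of_nonneg_left ?_ (integral_nonneg fun _ => norm_nonneg _)
        refine integral_mono (h2.const_mul _) (h3.const_mul _) fun t => ?_
        have h := sqrt_one_add_norm_sq_add_le t (ξ - t)
        rw [add_sub_cancel] at h
        calc _ ≤ 2 * (Real.sqrt (1 + ‖t‖ ^ 2) * Real.sqrt (1 + ‖ξ - t‖ ^ 2)) *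
              (‖f t‖ * ‖g (ξ - t)‖ ^ 2) := by gcongr
          _ = _ := by ring
    _ = _ := by rw [integral_const_mul]; ring

/-- Multiplication by a Schwartz function is bounded on the Sobolev space `H^{1/2}`. -/
theorem SchwartzMap.integral_weight_mul_norm_fourier_mul_sq_le (f g : 𝓢(E, ℂ)) :
    ∫ ξ, Real.sqrt (1 + ‖ξ‖ ^ 2) * ‖𝓕 (fun x => f x * g x) ξ‖ ^ 2 ≤
      2 * (∫ t, ‖𝓕 f t‖) * (∫ t, Real.sqrt (1 + ‖t‖ ^ 2) * ‖𝓕 f t‖) *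
        ∫ ξ, Real.sqrt (1 + ‖ξ‖ ^ 2) * ‖𝓕 g ξ‖ ^ 2 := by
  have hw : Continuous fun x : E => Real.sqrt (1 + ‖x‖ ^ 2) := by fun_prop
  have hK : ∀ x : E, ‖Real.sqrt (1 + ‖x‖ ^ 2)‖ ≤ 1 * (1 + ‖x‖ ^ 2) := fun x => by
    rw [Real.norm_of_nonneg (Real.sqrt_nonneg _), one_mul]
    exact sqrt_one_add_norm_sq_le_one_add_sq x
  have hf := (𝓕 f).integrable_mul_norm hw hK
  have hg := (𝓕 g).integrable_mul_norm_sq hw hK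
  have hconv := hf.integrable_convolution (ContinuousLinearMap.mul ℝ ℝ) hg
  have hint := integral_convolution (μ := volume) (ν := volume) (ContinuousLinearMap.mul ℝ ℝ) hf hg
  simp only [ContinuousLinearMap.mul_apply'] at hint
  rw [mul_assoc (2 * _), ← hint, ← integral_const_mul]
  refine integral_mono_of_nonneg (.of_forall fun ξ => by positivity) (hconv.const_mul _)
    (.of_forall fun ξ => ?_)
  simp only [SchwartzMap.fourier_mul_eq_convolution]
  exact (𝓕 f).weight_mul_norm_integral_sq_le (𝓕 g) ξ

end SobolevMultiplier

theorem continuous_pAbs {n : ℕ} (s : ℝ) (e₁ e₂ : EuclideanSpace ℝ (Fin n)) :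
    Continuous (pAbs s e₁ e₂) := by
  unfold pAbs
  fun_prop

theorem pAbs_le {n : ℕ} {s : ℝ} (hs : 0 ≤ s) {e₁ e₂ : EuclideanSpace ℝ (Fin n)}
    (h₁ : ‖e₁‖ = 1) (h₂ : ‖e₂‖ = 1) (ξ : EuclideanSpace ℝ (Fin n)) :
    pAbs s e₁ e₂ ξ ≤ ‖ξ‖ ^ 2 + 4 * s * ‖ξ‖ := by
  have i₁ := abs_real_inner_le_norm e₁ ξ
  have i₂ := abs_real_inner_le_norm e₂ ξ
  rw [h₁, one_mul] at i₁
  rw [h₂, one_mul, abs_le] at i₂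
  have j₁ := sq_le_sq' (abs_le.1 i₁).1 (abs_le.1 i₁).2
  have j₂ : (‖ξ‖ ^ 2 - 2 * s * ⟪e₂, ξ⟫) ^ 2 ≤ (‖ξ‖ ^ 2 + 2 * s * ‖ξ‖) ^ 2 := by
    apply sq_le_sq'
    · nlinarith [sq_nonneg ‖ξ‖, mul_le_mul_of_nonneg_left i₂.2 hs]
    · nlinarith [mul_le_mul_of_nonneg_left i₂.1 hs]
  refine Real.sqrt_le_iff.2 ⟨by positivity, ?_⟩
  have := mul_le_mul_of_nonneg_left j₁ (by positivity : 0 ≤ 4 * s ^ 2)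
  have : 0 ≤ s * ‖ξ‖ ^ 3 := by positivity
  have : 0 ≤ s ^ 2 * ‖ξ‖ ^ 2 := by positivity
  nlinarith

theorem norm_sq_sub_le_pAbs {n : ℕ} {s : ℝ} (hs : 0 ≤ s) (e₁ : EuclideanSpace ℝ (Fin n))
    {e₂ : EuclideanSpace ℝ (Fin n)} (h₂ : ‖e₂‖ = 1) (ξ : EuclideanSpace ℝ (Fin n)) :
    ‖ξ‖ ^ 2 - 2 * s * ‖ξ‖ ≤ pAbs s e₁ e₂ ξ := by
  have i₂ := real_inner_le_norm e₂ ξ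
  rw [h₂, one_mul] at i₂
  calc ‖ξ‖ ^ 2 - 2 * s * ‖ξ‖ ≤ ‖ξ‖ ^ 2 - 2 * s * ⟪e₂, ξ⟫ := by gcongr
    _ ≤ _ := Real.le_sqrt_of_sq_le (by nlinarith [sq_nonneg (s * ⟪e₁, ξ⟫)])

/-- The weight of `H^{1/2}` is dominated by that of `X^{1/2}_ζ`. -/
theorem sqrt_one_add_norm_sq_le_pAbs {n : ℕ} {s : ℝ} (hs : 1 ≤ s)
    (e₁ : EuclideanSpace ℝ (Fin n)) {e₂ : EuclideanSpace ℝ (Fin n)} (h₂ : ‖e₂‖ = 1)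
    (ξ : EuclideanSpace ℝ (Fin n)) :
    Real.sqrt (1 + ‖ξ‖ ^ 2) ≤ 5 * (s + pAbs s e₁ e₂ ξ) := by
  have hp := norm_sq_sub_le_pAbs (s := s) (by linarith) e₁ h₂ ξ
  have hp0 : 0 ≤ pAbs s e₁ e₂ ξ := Real.sqrt_nonneg _
  have h0 := norm_nonneg ξ
  have h := sqrt_one_add_norm_sq_le ξ
  rcases le_total ‖ξ‖ (4 * s) with hle | hle
  · linarith
  · nlinarith

/-- `‖Φu‖_{H^{1/2,2}} ≲ ‖u‖_{X^{1/2}_ζ}` uniformly over `s ≥ 1` and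
orthonormal `e₁, e₂`, for a fixed Schwartz cutoff `Φ`. -/
theorem stmt_9 (n : ℕ) (hn : 2 ≤ n)
    (Φ : SchwartzMap (EuclideanSpace ℝ (Fin n)) ℂ) :
    ∃ C > 0, ∀ s ≥ (1 : ℝ), ∀ e₁ e₂ : EuclideanSpace ℝ (Fin n),
      ‖e₁‖ = 1 → ‖e₂‖ = 1 → ⟪e₁, e₂⟫ = 0 →
      ∀ u : SchwartzMap (EuclideanSpace ℝ (Fin n)) ℂ,
        ∫ ξ, Real.sqrt (1 + ‖ξ‖ ^ 2) * ‖𝓕 (fun x => Φ x * u x) ξ‖ ^ 2 ≤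
          C * ∫ ξ, (s + pAbs s e₁ e₂ ξ) * ‖𝓕 (⇑u) ξ‖ ^ 2 := by
  set A := 2 * (∫ t, ‖𝓕 Φ t‖) * ∫ t, Real.sqrt (1 + ‖t‖ ^ 2) * ‖𝓕 Φ t‖
  have hA : 0 ≤ A := by positivity
  refine ⟨A * 5 + 1, by positivity, fun s hs e₁ e₂ h₁ h₂ _ u => ?_⟩
  have hp0 : ∀ ξ, 0 ≤ s + pAbs s e₁ e₂ ξ := fun ξ =>
    add_nonneg (by linarith) (Real.sqrt_nonneg _)
  have hint : Integrable fun ξ => (s + pAbs s e₁ e₂ ξ) * ‖𝓕 u ξ‖ ^ 2 := by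
    refine (𝓕 u).integrable_mul_norm_sq (φ := fun ξ => s + pAbs s e₁ e₂ ξ) (K := 1 + 3 * s)
      (continuous_const.add (continuous_pAbs s e₁ e₂)) fun ξ => ?_
    rw [Real.norm_of_nonneg (hp0 ξ)]
    have := pAbs_le (s := s) (by linarith) h₁ h₂ ξ
    nlinarith [mul_nonneg (by linarith : 0 ≤ s) (sq_nonneg (‖ξ‖ - 1))]
  have hnonneg : 0 ≤ ∫ ξ, (s + pAbs s e₁ e₂ ξ) * ‖𝓕 u ξ‖ ^ 2 :=
    integral_nonneg fun ξ => mul_nonneg (hp0 ξ) (by positivity)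
  have hmono : ∫ ξ, Real.sqrt (1 + ‖ξ‖ ^ 2) * ‖𝓕 u ξ‖ ^ 2 ≤
      5 * ∫ ξ, (s + pAbs s e₁ e₂ ξ) * ‖𝓕 u ξ‖ ^ 2 := by
    rw [← integral_const_mul]
    refine integral_mono_of_nonneg (.of_forall fun ξ => by positivity) (hint.const_mul _)
      (.of_forall fun ξ => ?_)
    simp only [← mul_assoc]
    gcongr
    exact sqrt_one_add_norm_sq_le_pAbs hs e₁ h₂ ξ
  refine (SchwartzMap.integral_weight_mul_norm_fourier_mul_sq_le Φ u).trans ?_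
  calc _ ≤ A * (5 * ∫ ξ, (s + pAbs s e₁ e₂ ξ) * ‖𝓕 u ξ‖ ^ 2) :=
        mul_le_mul_of_nonneg_left hmono hA
    _ ≤ (A * 5 + 1) * ∫ ξ, (s + pAbs s e₁ e₂ ξ) * ‖𝓕 u ξ‖ ^ 2 := by linarith
end

section
/- Let n ≥ 2 and let Φ : ℝⁿ → ℂ be a Schwartz function. There is a constant C > 0, depending only on Φ and n, such that for all s ≥ 1, all orthonormal unit vectors e₁, e₂ ∈ ℝⁿ, and every Schwartz function u : ℝⁿ → ℂ: ∫_{ℝⁿ} (1 + ‖ξ‖²) |𝓕(Φu)(ξ)|² dξ ≤ C s ∫_{ℝⁿ} |p_ζ(ξ)| |𝓕u(ξ)|² dξ. (Equivalently, ‖Φu‖_{H^{1,2}} ≲ s^{1/2} ‖u‖_{Ẋ^{1/2}_ζ}.) -/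
open MeasureTheory
open scoped RealInnerProductSpace FourierTransform

section

open scoped ENNReal

/-- The function `|t|^{-1/2}` truncated to `|t| ≤ 1/2`. -/
noncomputable def truncInvSqrt (t : ℝ) : ℝ≥0∞ :=
  if |t| ≤ 1 / 2 then (ENNReal.ofReal (Real.sqrt |t|))⁻¹ else 0

@[fun_prop]
lemma measurable_truncInvSqrt : Measurable truncInvSqrt := by
  unfold truncInvSqrt
  refine Measurable.ite (measurableSet_le (by fun_prop) (by fun_prop)) (by fun_prop) (by fun_prop)

lemma lintegral_truncInvSqrt_lt_top : ∫⁻ t, truncInvSqrt t < ∞ := by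
  have h1 : IntervalIntegrable (fun t : ℝ => t ^ (-(1 / 2) : ℝ)) volume 0 (1 / 2) :=
    intervalIntegral.intervalIntegrable_rpow' (by norm_num)
  rw [intervalIntegrable_iff_integrableOn_Ioc_of_le (by norm_num)] at h1
  have hpos : ∫⁻ t in Set.Ioi 0, truncInvSqrt t < ∞ := by
    refine lt_of_le_of_lt ?_ h1.2
    rw [← lintegral_indicator measurableSet_Ioi, ← lintegral_indicator measurableSet_Ioc]
    refine lintegral_mono fun t => ?_
    by_cases ht : 0 < t
    · by_cases ht' : t ≤ 1 / 2
      · rw [Set.indicator_of_mem (by exact ht), Set.indicator_of_mem (by exact ⟨ht, ht'⟩),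
          truncInvSqrt, abs_of_pos ht, if_pos ht']
        dsimp only
        rw [Real.rpow_neg ht.le, ← Real.sqrt_eq_rpow,
          Real.enorm_of_nonneg (by positivity), ENNReal.ofReal_inv_of_pos (by positivity)]
      · rw [Set.indicator_of_mem (by exact ht), truncInvSqrt, abs_of_pos ht, if_neg ht']
        exact zero_le
    · simp [Set.indicator, ht]
  have hneg : ∫⁻ t in Set.Iio 0, truncInvSqrt t = ∫⁻ t in Set.Ioi 0, truncInvSqrt t := by
    rw [← lintegral_indicator measurableSet_Ioi, ← lintegral_indicator measurableSet_Iio,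
      ← lintegral_neg_eq_self]
    refine lintegral_congr fun t => ?_
    simp [Set.indicator, truncInvSqrt]
  have hsplit : ∫⁻ t, truncInvSqrt t
      = (∫⁻ t in Set.Iic 0, truncInvSqrt t) + ∫⁻ t in Set.Ioi 0, truncInvSqrt t := by
    rw [← lintegral_add_compl _ (measurableSet_Iic (a := (0 : ℝ))), Set.compl_Iic]
  rw [hsplit, setLIntegral_congr (Iio_ae_eq_Iic (a := (0 : ℝ))).symm, hneg]
  exact ENNReal.add_lt_top.2 ⟨hpos, hpos⟩

lemma lintegral_wt_lt_top : ∫⁻ t : ℝ, ENNReal.ofReal (1 + t ^ 2)⁻¹ < ∞ := by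
  have := integrable_inv_one_add_sq.2
  refine lt_of_eq_of_lt (lintegral_congr fun t => ?_) this
  rw [Real.enorm_of_nonneg (by positivity)]

/-- Substitution bound for a quadratic polynomial away from its critical point. -/
lemma setLIntegral_comp_sq_div_add_le (h : ℝ → ℝ≥0∞) {s κ : ℝ} (hs : 0 < s) (hκ : 0 < κ) (b : ℝ) :
    ∫⁻ t in Set.Ici (κ * s), h (t ^ 2 / s + b) ≤ (ENNReal.ofReal (2 * κ))⁻¹ * ∫⁻ u, h u := by
  have hinj : Set.InjOn (fun t : ℝ => t ^ 2 / s + b) (Set.Ici (κ * s)) := by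
    intro x hx y hy hxy
    have hx0 : 0 ≤ x := (mul_pos hκ hs).le.trans hx
    have hy0 : 0 ≤ y := (mul_pos hκ hs).le.trans hy
    have : x ^ 2 = y ^ 2 := by
      have := add_right_cancel hxy
      field_simp at this
      exact this
    exact (pow_left_inj₀ hx0 hy0 two_ne_zero).1 this
  have key := lintegral_image_eq_lintegral_abs_deriv_mul (s := Set.Ici (κ * s))
    (f := fun t : ℝ => t ^ 2 / s + b) (f' := fun t => 2 * t / s) measurableSet_Ici
    (fun x _ => by
      have := (((hasDerivAt_pow 2 x).div_const s).add_const b).hasDerivWithinAt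
        (s := Set.Ici (κ * s))
      simpa using this) hinj h
  rw [← ENNReal.div_eq_inv_mul, ENNReal.le_div_iff_mul_le (by left; simpa using hκ)
    (.inl ENNReal.ofReal_ne_top),
    mul_comm]
  calc _ = ∫⁻ t in Set.Ici (κ * s), ENNReal.ofReal (2 * κ) * h (t ^ 2 / s + b) := by
        rw [lintegral_const_mul' _ _ ENNReal.ofReal_ne_top]
    _ ≤ ∫⁻ t in Set.Ici (κ * s), ENNReal.ofReal |2 * t / s| * h (t ^ 2 / s + b) := by
        refine setLIntegral_mono' measurableSet_Ici fun t ht => ?_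
        gcongr
        refine le_trans ?_ (le_abs_self _)
        rw [le_div_iff₀ hs]
        have : κ * s ≤ t := ht
        linarith
    _ ≤ _ := by
        rw [← key]
        exact setLIntegral_le_lintegral _ _

lemma lintegral_indicator_comp_sq_div_add_le (h : ℝ → ℝ≥0∞) {s κ : ℝ} (hs : 0 < s) (hκ : 0 < κ)
    (b c : ℝ) :
    ∫⁻ t, (if κ * s ≤ |t - c| then h ((t - c) ^ 2 / s + b) else 0)
      ≤ (ENNReal.ofReal κ)⁻¹ * ∫⁻ u, h u := by
  rw [lintegral_sub_right_eq_self (fun t => if κ * s ≤ |t| then h (t ^ 2 / s + b) else 0) c]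
  have hset : MeasurableSet {t : ℝ | κ * s ≤ |t|} := measurableSet_le (by fun_prop) (by fun_prop)
  have h1 : ∫⁻ t, (if κ * s ≤ |t| then h (t ^ 2 / s + b) else 0)
      = ∫⁻ t in {t : ℝ | κ * s ≤ |t|}, h (t ^ 2 / s + b) := by
    rw [← lintegral_indicator hset]
    rfl
  have h2 : {t : ℝ | κ * s ≤ |t|} = Set.Ici (κ * s) ∪ Set.Iic (-(κ * s)) := by
    ext t
    simp only [Set.mem_ofPred_eq, le_abs, Set.mem_union, Set.mem_Ici, Set.mem_Iic]
    constructor <;> rintro (h | h) <;> [left; right; left; right] <;> linarith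
  have h3 : ∫⁻ t in Set.Iic (-(κ * s)), h (t ^ 2 / s + b)
      = ∫⁻ t in Set.Ici (κ * s), h (t ^ 2 / s + b) := by
    rw [← lintegral_indicator measurableSet_Ici, ← lintegral_indicator measurableSet_Iic,
      ← lintegral_neg_eq_self]
    refine lintegral_congr fun t => ?_
    simp [Set.indicator]
  rw [h1, h2]
  refine (lintegral_union_le _ _ _).trans ?_
  rw [h3]
  have h4 := setLIntegral_comp_sq_div_add_le h hs hκ b
  refine (add_le_add h4 h4).trans_eq ?_
  rw [← add_mul, ENNReal.ofReal_mul (by norm_num),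
    ENNReal.mul_inv (by simp) (by simp), ← add_mul]
  norm_num [ENNReal.inv_two_add_inv_two]

lemma lintegral_prod_le_pow {m : ℕ} (g : Fin m → ℝ → ℝ≥0∞) (hg : ∀ i, Measurable (g i))
    {M : ℝ≥0∞} (hM : ∀ i, ∫⁻ t, g i t ≤ M) :
    ∫⁻ x : Fin m → ℝ, ∏ i, g i (x i) ≤ M ^ m := by
  induction m with
  | zero => simp [volume_pi]
  | succ m ih =>
    rw [← (volume_preserving_piFinSuccAbove (fun _ : Fin (m + 1) => ℝ) 0).symm.lintegral_comp
      (f := fun x : Fin (m + 1) → ℝ => ∏ i, g i (x i))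
      (Finset.measurable_prod _ fun i _ => (hg i).comp (measurable_pi_apply i))]
    simp only [MeasurableEquiv.piFinSuccAbove_symm_apply, Fin.insertNthEquiv, Equiv.coe_fn_mk,
      Fin.prod_univ_succAbove _ 0, Fin.insertNth_apply_same, Fin.insertNth_apply_succAbove]
    have hmeas : Measurable fun y : Fin m → ℝ => ∏ i, g (Fin.succAbove 0 i) (y i) :=
      Finset.measurable_prod _ fun i _ => (hg _).comp (measurable_pi_apply i)
    rw [Measure.volume_eq_prod, lintegral_prod_mul (hg 0).aemeasurable hmeas.aemeasurable,
      pow_succ']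
    gcongr
    · exact hM 0
    · exact ih _ (fun i => hg _) fun i => hM _

/-- Integrating first in the direction `j`, in which the quadratic `(∑ (xᵢ - cᵢ)² - s²) / s` is
nondegenerate. -/
lemma lintegral_prod_mul_quadratic_le {m : ℕ} (j : Fin (m + 1)) (g : Fin (m + 1) → ℝ → ℝ≥0∞)
    (hg : ∀ i, Measurable (g i)) {M : ℝ≥0∞} (hM : ∀ i, ∫⁻ t, g i t ≤ M)
    (h : ℝ → ℝ≥0∞) (hh : Measurable h) {s κ : ℝ} (hs : 0 < s) (hκ : 0 < κ) (c : Fin (m + 1) → ℝ) :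
    ∫⁻ x : Fin (m + 1) → ℝ, (∏ i : Fin m, g (j.succAbove i) (x (j.succAbove i))) *
      (if κ * s ≤ |x j - c j| then h ((∑ i, (x i - c i) ^ 2 - s ^ 2) / s) else 0)
      ≤ M ^ m * ((ENNReal.ofReal κ)⁻¹ * ∫⁻ u, h u) := by
  have hmeas : Measurable fun x : Fin (m + 1) → ℝ =>
      (∏ i : Fin m, g (j.succAbove i) (x (j.succAbove i))) *
      (if κ * s ≤ |x j - c j| then h ((∑ i, (x i - c i) ^ 2 - s ^ 2) / s) else 0) := by
    refine (Finset.measurable_prod _ fun i _ => (hg _).comp (measurable_pi_apply _)).mul ?_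
    exact Measurable.ite (measurableSet_le (by fun_prop) (by fun_prop)) (by fun_prop) (by fun_prop)
  have hmp := (volume_preserving_piFinSuccAbove (fun _ : Fin (m + 1) => ℝ) j).symm
  rw [← hmp.lintegral_comp hmeas, Measure.volume_eq_prod]
  refine (lintegral_prod_symm' _ (hmeas.comp hmp.measurable)).trans_le ?_
  simp only [Function.comp_apply, MeasurableEquiv.piFinSuccAbove_symm_apply, Fin.insertNthEquiv,
    Equiv.coe_fn_mk, Fin.insertNth_apply_same, Fin.insertNth_apply_succAbove, Fin.sum_univ_succAbove _ j]
  calc _ ≤ ∫⁻ y : Fin m → ℝ, (∏ i : Fin m, g (j.succAbove i) (y i)) *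
        ((ENNReal.ofReal κ)⁻¹ * ∫⁻ u, h u) := by
        refine lintegral_mono fun y => ?_
        dsimp only
        rw [lintegral_const_mul _ (Measurable.ite (measurableSet_le (by fun_prop) (by fun_prop))
          (by fun_prop) (by fun_prop))]
        gcongr
        refine le_trans (le_of_eq ?_) (lintegral_indicator_comp_sq_div_add_le h hs hκ
          ((∑ i, (y i - c (j.succAbove i)) ^ 2 - s ^ 2) / s) (c j))
        refine lintegral_congr fun t => ?_
        congr 2
        ring
    _ ≤ _ := by
        have hprod : Measurable fun y : Fin m → ℝ => ∏ i, g (j.succAbove i) (y i) :=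
          Finset.measurable_prod _ fun i _ => (hg _).comp (measurable_pi_apply i)
        rw [lintegral_mul_const _ hprod]
        gcongr
        exact lintegral_prod_le_pow _ (fun i => hg _) fun i => hM _

lemma exists_coord_ge {m : ℕ} {s : ℝ} (hs : 1 ≤ s) {x c : Fin (m + 1) → ℝ} (hc0 : c 0 = 0)
    (hx : |x 0| ≤ 1 / 2) (hq : |(∑ i, (x i - c i) ^ 2 - s ^ 2) / s| ≤ 1 / 2) :
    ∃ k : Fin m, (2 * ((m : ℝ) + 1))⁻¹ * s ≤ |x k.succ - c k.succ| := by
  by_contra! hcon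
  have hs0 : 0 < s := by linarith
  set κ : ℝ := (2 * ((m : ℝ) + 1))⁻¹ with hκ
  have hκ0 : 0 < κ := by positivity
  have h1 : ∑ k : Fin m, (x k.succ - c k.succ) ^ 2 ≤ m * (κ * s) ^ 2 := by
    calc _ ≤ ∑ _k : Fin m, (κ * s) ^ 2 := by
          refine Finset.sum_le_sum fun k _ => ?_
          rw [← sq_abs]
          exact pow_le_pow_left₀ (abs_nonneg _) (hcon k).le 2
      _ = _ := by simp
  have h2 : m * κ ^ 2 ≤ 1 / 16 := by
    rw [hκ, inv_pow, ← div_eq_mul_inv, div_le_iff₀ (by positivity)]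
    nlinarith [sq_nonneg ((m : ℝ) - 1)]
  have h3 : x 0 ^ 2 ≤ 1 / 4 := by
    rw [← sq_abs]
    nlinarith [abs_nonneg (x 0)]
  rw [Fin.sum_univ_succ, hc0, sub_zero, abs_le, le_div_iff₀ hs0] at hq
  nlinarith [hq.1, sq_nonneg s, mul_le_mul_of_nonneg_right h2 (sq_nonneg s)]

lemma lintegral_prod_wt_mul_truncInvSqrt_le {m : ℕ} {s : ℝ} (hs : 1 ≤ s)
    (p c : Fin (m + 1) → ℝ) (hc0 : c 0 = 0) :
    ∫⁻ x : Fin (m + 1) → ℝ, (∏ i, ENNReal.ofReal (1 + (p i - x i) ^ 2)⁻¹) *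
      (truncInvSqrt (x 0) * truncInvSqrt ((∑ i, (x i - c i) ^ 2 - s ^ 2) / s))
      ≤ m * (((∫⁻ t, truncInvSqrt t) + ∫⁻ t : ℝ, ENNReal.ofReal (1 + t ^ 2)⁻¹) ^ m *
        ((ENNReal.ofReal (2 * ((m : ℝ) + 1))⁻¹)⁻¹ * ∫⁻ t, truncInvSqrt t)) := by
  have hs0 : 0 < s := by linarith
  set κ : ℝ := (2 * ((m : ℝ) + 1))⁻¹ with hκ
  have hκ0 : 0 < κ := by positivity
  have hwt : ∀ t : ℝ, ENNReal.ofReal (1 + t ^ 2)⁻¹ ≤ 1 := fun t => by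
    rw [← ENNReal.ofReal_one]
    exact ENNReal.ofReal_le_ofReal (inv_le_one_of_one_le₀ (by nlinarith [sq_nonneg t]))
  set g : Fin (m + 1) → ℝ → ℝ≥0∞ := fun i t =>
    (if i = 0 then truncInvSqrt t else 1) * ENNReal.ofReal (1 + (p i - t) ^ 2)⁻¹ with hg
  have hgm : ∀ i, Measurable (g i) := fun i => by
    by_cases hi : i = 0
    · simp only [hg, hi, if_true]
      fun_prop
    · simp only [hg, hi, if_false]
      fun_prop
  have hgM : ∀ i, ∫⁻ t, g i t ≤
      (∫⁻ t, truncInvSqrt t) + ∫⁻ t : ℝ, ENNReal.ofReal (1 + t ^ 2)⁻¹ := fun i => by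
    by_cases hi : i = 0
    · refine le_trans (lintegral_mono fun t => ?_) le_self_add
      simp only [hg, hi, if_true]
      exact mul_le_of_le_one_right' (hwt _)
    · refine le_trans (le_of_eq ?_) le_add_self
      simp only [hg, hi, if_false, one_mul]
      exact lintegral_sub_left_eq_self (fun t : ℝ => ENNReal.ofReal (1 + t ^ 2)⁻¹) (p i)
  calc _ ≤ ∫⁻ x : Fin (m + 1) → ℝ, ∑ k : Fin m,
        (∏ i : Fin m, g (k.succ.succAbove i) (x (k.succ.succAbove i))) *
        (if κ * s ≤ |x k.succ - c k.succ| then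
          truncInvSqrt ((∑ i, (x i - c i) ^ 2 - s ^ 2) / s) else 0) := by
        refine lintegral_mono fun x => ?_
        dsimp only
        by_cases hx : |x 0| ≤ 1 / 2
        swap
        · simp only [truncInvSqrt, if_neg hx, mul_zero, zero_mul]
          exact zero_le
        by_cases hq : |(∑ i, (x i - c i) ^ 2 - s ^ 2) / s| ≤ 1 / 2
        swap
        · simp only [truncInvSqrt, if_neg hq, mul_zero]
          exact zero_le
        obtain ⟨k, hk⟩ := exists_coord_ge hs hc0 hx hq
        refine le_trans ?_ (Finset.single_le_sum (fun _ _ => zero_le) (Finset.mem_univ k))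
        rw [if_pos hk, ← mul_assoc]
        gcongr
        have hprod : ∏ i : Fin m, g (k.succ.succAbove i) (x (k.succ.succAbove i))
            = truncInvSqrt (x 0) * ∏ i : Fin m,
              ENNReal.ofReal (1 + (p (k.succ.succAbove i) - x (k.succ.succAbove i)) ^ 2)⁻¹ := by
          simp only [hg, Finset.prod_mul_distrib]
          congr 1
          have := Fin.prod_univ_succAbove
            (fun i : Fin (m + 1) => if i = 0 then truncInvSqrt (x i) else 1) k.succ
          simpa using this.symm
        rw [hprod, Fin.prod_univ_succAbove _ k.succ, mul_comm]
        gcongr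
        exact mul_le_of_le_one_left' (hwt _)
    _ = ∑ k : Fin m, ∫⁻ x : Fin (m + 1) → ℝ,
        (∏ i : Fin m, g (k.succ.succAbove i) (x (k.succ.succAbove i))) *
        (if κ * s ≤ |x k.succ - c k.succ| then
          truncInvSqrt ((∑ i, (x i - c i) ^ 2 - s ^ 2) / s) else 0) := by
        refine lintegral_finsetSum _ fun k _ => ?_
        refine (Finset.measurable_prod _ fun i _ => (hgm _).comp (measurable_pi_apply _)).mul ?_
        exact Measurable.ite (measurableSet_le (by fun_prop) (by fun_prop)) (by fun_prop)
          (by fun_prop)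
    _ ≤ ∑ _k : Fin m, _ := Finset.sum_le_sum fun k _ =>
        lintegral_prod_mul_quadratic_le k.succ g hgm hgM _ measurable_truncInvSqrt hs0 hκ0 c
    _ = _ := by simp

lemma exists_orthonormalBasis_zero_eq {m : ℕ} {e : EuclideanSpace ℝ (Fin (m + 1))}
    (he : ‖e‖ = 1) :
    ∃ b : OrthonormalBasis (Fin (m + 1)) ℝ (EuclideanSpace ℝ (Fin (m + 1))), b 0 = e := by
  obtain ⟨b, hb⟩ := Orthonormal.exists_orthonormalBasis_extension_of_card_eq (𝕜 := ℝ)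
    (E := EuclideanSpace ℝ (Fin (m + 1))) (ι := Fin (m + 1)) (by simp) (v := fun _ => e)
    (s := {0}) (by
      refine ⟨fun i => by simpa using he, fun i j hij => ?_⟩
      exact absurd (Subsingleton.elim i j) hij)
  exact ⟨b, hb 0 rfl⟩

lemma lintegral_decay_mul_truncInvSqrt_le {m : ℕ} {s : ℝ} (hs : 1 ≤ s)
    {e₁ e₂ : EuclideanSpace ℝ (Fin (m + 1))} (h₁ : ‖e₁‖ = 1) (h₂ : ‖e₂‖ = 1)
    (h₁₂ : ⟪e₁, e₂⟫ = 0) (ξ : EuclideanSpace ℝ (Fin (m + 1))) :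
    ∫⁻ η, ENNReal.ofReal ((1 + ‖ξ - η‖ ^ 2) ^ (m + 1))⁻¹ *
      (truncInvSqrt ⟪e₁, η⟫ * truncInvSqrt ((‖η‖ ^ 2 - 2 * s * ⟪e₂, η⟫) / s))
      ≤ m * (((∫⁻ t, truncInvSqrt t) + ∫⁻ t : ℝ, ENNReal.ofReal (1 + t ^ 2)⁻¹) ^ m *
        ((ENNReal.ofReal (2 * ((m : ℝ) + 1))⁻¹)⁻¹ * ∫⁻ t, truncInvSqrt t)) := by
  obtain ⟨b, hb⟩ := exists_orthonormalBasis_zero_eq h₁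
  have hnorm : ∀ v, ‖v‖ ^ 2 = ∑ i, (b.repr v i) ^ 2 := fun v => by
    rw [← b.repr.norm_map v, EuclideanSpace.real_norm_sq_eq]
  set F : (Fin (m + 1) → ℝ) → ℝ≥0∞ := fun x =>
    (∏ i, ENNReal.ofReal (1 + (b.repr ξ i - x i) ^ 2)⁻¹) * (truncInvSqrt (x 0) *
      truncInvSqrt ((∑ i, (x i - s * b.repr e₂ i) ^ 2 - s ^ 2) / s)) with hF
  have hFm : Measurable F :=
    (Finset.measurable_prod _ fun i _ => by fun_prop).mul (by fun_prop)
  have hmp : MeasurePreserving (fun η i => b.repr η i) volume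
      (volume : Measure (Fin (m + 1) → ℝ)) :=
    (PiLp.volume_preserving_ofLp (Fin (m + 1))).comp b.measurePreserving_repr
  calc _ ≤ ∫⁻ η, F (fun i => b.repr η i) := lintegral_mono fun η => ?_
    _ = ∫⁻ x, F x := hmp.lintegral_comp hFm
    _ ≤ _ := lintegral_prod_wt_mul_truncInvSqrt_le hs (fun i => b.repr ξ i)
      (fun i => s * b.repr e₂ i) (by simp [b.repr_apply_apply, hb, h₁₂])
  have hq : ∑ i, (b.repr η i - s * b.repr e₂ i) ^ 2 - s ^ 2 = ‖η‖ ^ 2 - 2 * s * ⟪e₂, η⟫ := by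
    have h := hnorm (η - s • e₂)
    simp only [map_sub, map_smul, PiLp.sub_apply, PiLp.smul_apply, smul_eq_mul] at h
    rw [← h, norm_sub_sq_real, norm_smul, inner_smul_right, h₂, real_inner_comm, mul_one,
      Real.norm_eq_abs, sq_abs]
    ring
  have h0 : b.repr η 0 = ⟪e₁, η⟫ := by rw [b.repr_apply_apply, hb]
  simp only [hF]
  rw [hq, h0]
  gcongr
  rw [← ENNReal.ofReal_prod_of_nonneg fun i _ => by positivity]
  refine ENNReal.ofReal_le_ofReal ?_
  rw [Finset.prod_inv_distrib]
  refine inv_anti₀ (Finset.prod_pos fun i _ => by positivity) ?_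
  have : ∀ i, 1 + (b.repr ξ i - b.repr η i) ^ 2 ≤ 1 + ‖ξ - η‖ ^ 2 := fun i => by
    rw [hnorm]
    have := Finset.single_le_sum (f := fun i => (b.repr (ξ - η) i) ^ 2)
      (fun i _ => sq_nonneg _) (Finset.mem_univ i)
    simp only [map_sub, PiLp.sub_apply] at this ⊢
    linarith
  calc _ ≤ ∏ _i : Fin (m + 1), (1 + ‖ξ - η‖ ^ 2) :=
        Finset.prod_le_prod (fun i _ => by positivity) fun i _ => this i
    _ = _ := by simp

lemma ofReal_div_pAbs_le {n : ℕ} {s : ℝ} (hs : 1 ≤ s) {e₁ e₂ : EuclideanSpace ℝ (Fin n)}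
    (h₂ : ‖e₂‖ = 1) (η : EuclideanSpace ℝ (Fin n)) :
    ENNReal.ofReal (1 + ‖η‖ ^ 2) / ENNReal.ofReal (pAbs s e₁ e₂ η) ≤
      ENNReal.ofReal (34 * s) + ENNReal.ofReal (17 * s) *
        (truncInvSqrt ⟪e₁, η⟫ * truncInvSqrt ((‖η‖ ^ 2 - 2 * s * ⟪e₂, η⟫) / s)) := by
  have hs0 : 0 < s := by linarith
  have hin : |⟪e₂, η⟫| ≤ ‖η‖ := by simpa [h₂] using abs_real_inner_le_norm e₂ η
  set a := ⟪e₁, η⟫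
  set q := (‖η‖ ^ 2 - 2 * s * ⟪e₂, η⟫) / s with hq
  have hsq : ‖η‖ ^ 2 - 2 * s * ⟪e₂, η⟫ = s * q := by rw [hq]; field_simp
  have hp : pAbs s e₁ e₂ η = Real.sqrt ((s * q) ^ 2 + 4 * s ^ 2 * a ^ 2) := by
    rw [pAbs, hsq]
  have hpq : s * |q| ≤ pAbs s e₁ e₂ η := by
    rw [hp]
    refine Real.le_sqrt_of_sq_le ?_
    rw [mul_pow, sq_abs, mul_pow]
    nlinarith [mul_nonneg (sq_nonneg s) (sq_nonneg a)]
  have hpa : 2 * s * |a| ≤ pAbs s e₁ e₂ η := by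
    rw [hp]
    refine Real.le_sqrt_of_sq_le ?_
    rw [mul_pow, sq_abs]
    nlinarith [sq_nonneg (s * q)]
  have easy : 1 + ‖η‖ ^ 2 ≤ 34 * s * pAbs s e₁ e₂ η →
      ENNReal.ofReal (1 + ‖η‖ ^ 2) / ENNReal.ofReal (pAbs s e₁ e₂ η) ≤
      ENNReal.ofReal (34 * s) + ENNReal.ofReal (17 * s) * (truncInvSqrt a * truncInvSqrt q) := by
    intro h
    refine le_trans (ENNReal.div_le_of_le_mul ?_) le_self_add
    rw [← ENNReal.ofReal_mul (by positivity)]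
    exact ENNReal.ofReal_le_ofReal h
  by_cases hN : 4 * s ≤ ‖η‖
  · apply easy
    have h1 : ‖η‖ ^ 2 / 2 ≤ pAbs s e₁ e₂ η := by
      have : s * q ≤ s * |q| := mul_le_mul_of_nonneg_left (le_abs_self q) hs0.le
      have h3 := (abs_le.1 hin).2
      nlinarith
    nlinarith
  push Not at hN
  have hN2 : 1 + ‖η‖ ^ 2 ≤ 17 * s ^ 2 := by nlinarith [norm_nonneg η]
  by_cases ha : |a| ≤ 1 / 2
  swap
  · apply easy
    push Not at ha
    nlinarith
  by_cases hq' : |q| ≤ 1 / 2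
  swap
  · apply easy
    push Not at hq'
    nlinarith
  refine le_trans ?_ le_add_self
  rw [truncInvSqrt, truncInvSqrt, if_pos ha, if_pos hq']
  have hlow : s * (Real.sqrt |a| * Real.sqrt |q|) ≤ pAbs s e₁ e₂ η := by
    rw [hp]
    refine Real.le_sqrt_of_sq_le ?_
    rw [mul_pow, mul_pow, Real.sq_sqrt (abs_nonneg _), Real.sq_sqrt (abs_nonneg _), mul_pow]
    have : |a| * |q| ≤ q ^ 2 + 4 * a ^ 2 := by
      rw [← sq_abs a, ← sq_abs q]
      nlinarith [sq_nonneg (|a| - |q|), abs_nonneg a, abs_nonneg q]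
    nlinarith [sq_nonneg s]
  rw [← ENNReal.mul_inv (.inr ENNReal.ofReal_ne_top) (.inl ENNReal.ofReal_ne_top),
    ← ENNReal.ofReal_mul (by positivity), ← div_eq_mul_inv]
  calc _ ≤ ENNReal.ofReal (17 * s * s) /
        ENNReal.ofReal (s * (Real.sqrt |a| * Real.sqrt |q|)) := by
        gcongr
        nlinarith
    _ = _ := by
        rw [ENNReal.ofReal_mul (p := 17 * s) (by positivity), ENNReal.ofReal_mul (p := s) hs0.le,
          mul_comm (ENNReal.ofReal (17 * s)),
          ENNReal.mul_div_mul_left _ _ (by simpa using hs0) ENNReal.ofReal_ne_top]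

lemma lintegral_kernel_div_pAbs_le {m : ℕ} {s : ℝ} (hs : 1 ≤ s)
    {e₁ e₂ : EuclideanSpace ℝ (Fin (m + 1))} (h₁ : ‖e₁‖ = 1) (h₂ : ‖e₂‖ = 1)
    (h₁₂ : ⟪e₁, e₂⟫ = 0) {k : EuclideanSpace ℝ (Fin (m + 1)) → ℝ≥0∞} (hk : Measurable k)
    {A : ℝ≥0∞}
    (hA : ∀ ζ, k ζ * ENNReal.ofReal (1 + ‖ζ‖ ^ 2) ≤
      A * ENNReal.ofReal ((1 + ‖ζ‖ ^ 2) ^ (m + 1))⁻¹) (ξ : EuclideanSpace ℝ (Fin (m + 1))) :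
    ENNReal.ofReal (1 + ‖ξ‖ ^ 2) * ∫⁻ η, k (ξ - η) / ENNReal.ofReal (pAbs s e₁ e₂ η) ≤
      (2 * (34 * (∫⁻ ζ, k ζ * ENNReal.ofReal (1 + ‖ζ‖ ^ 2)) + 17 * (A * (m *
        (((∫⁻ t, truncInvSqrt t) + ∫⁻ t : ℝ, ENNReal.ofReal (1 + t ^ 2)⁻¹) ^ m *
        ((ENNReal.ofReal (2 * ((m : ℝ) + 1))⁻¹)⁻¹ * ∫⁻ t, truncInvSqrt t)))))) *
        ENNReal.ofReal s := by
  have hpm : Measurable fun η => pAbs s e₁ e₂ η := by unfold pAbs; fun_prop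
  set K : EuclideanSpace ℝ (Fin (m + 1)) → ℝ≥0∞ :=
    fun ζ => k ζ * ENNReal.ofReal (1 + ‖ζ‖ ^ 2) with hK
  set T : EuclideanSpace ℝ (Fin (m + 1)) → ℝ≥0∞ := fun η =>
    truncInvSqrt ⟪e₁, η⟫ * truncInvSqrt ((‖η‖ ^ 2 - 2 * s * ⟪e₂, η⟫) / s) with hT
  have hTm : Measurable T := by fun_prop
  have hKm : Measurable K := by fun_prop
  have hpeetre : ∀ η, ENNReal.ofReal (1 + ‖ξ‖ ^ 2) ≤
      2 * (ENNReal.ofReal (1 + ‖ξ - η‖ ^ 2) * ENNReal.ofReal (1 + ‖η‖ ^ 2)) := fun η => by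
    have htwo : ∀ x : ℝ, 2 * ENNReal.ofReal x = ENNReal.ofReal (2 * x) := fun x => by
      rw [ENNReal.ofReal_mul (by norm_num), ENNReal.ofReal_ofNat]
    rw [← ENNReal.ofReal_mul (by positivity), htwo]
    refine ENNReal.ofReal_le_ofReal ?_
    have h : ‖ξ‖ ≤ ‖ξ - η‖ + ‖η‖ := by simpa using norm_add_le (ξ - η) η
    have h' : ‖ξ‖ ^ 2 ≤ (‖ξ - η‖ + ‖η‖) ^ 2 := pow_le_pow_left₀ (norm_nonneg _) h 2
    nlinarith [sq_nonneg (‖ξ - η‖ - ‖η‖), mul_nonneg (sq_nonneg ‖ξ - η‖) (sq_nonneg ‖η‖)]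
  rw [← lintegral_const_mul _ (by fun_prop)]
  calc _ ≤ ∫⁻ η, 2 * (ENNReal.ofReal (34 * s) * K (ξ - η) + ENNReal.ofReal (17 * s) *
        (A * (ENNReal.ofReal ((1 + ‖ξ - η‖ ^ 2) ^ (m + 1))⁻¹ * T η))) := by
        refine lintegral_mono fun η => ?_
        calc _ ≤ 2 * (ENNReal.ofReal (1 + ‖ξ - η‖ ^ 2) * ENNReal.ofReal (1 + ‖η‖ ^ 2)) *
              (k (ξ - η) / ENNReal.ofReal (pAbs s e₁ e₂ η)) := by gcongr; exact hpeetre η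
          _ = 2 * (K (ξ - η) *
              (ENNReal.ofReal (1 + ‖η‖ ^ 2) / ENNReal.ofReal (pAbs s e₁ e₂ η))) := by
              simp only [hK, div_eq_mul_inv]; ring
          _ ≤ 2 * (K (ξ - η) * (ENNReal.ofReal (34 * s) + ENNReal.ofReal (17 * s) * T η)) := by
              gcongr
              exact ofReal_div_pAbs_le hs h₂ η
          _ = 2 * (ENNReal.ofReal (34 * s) * K (ξ - η) +
              ENNReal.ofReal (17 * s) * (K (ξ - η) * T η)) := by ring
          _ ≤ _ := by
              rw [← mul_assoc A]
              gcongr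
              exact hA (ξ - η)
    _ = 2 * (ENNReal.ofReal (34 * s) * (∫⁻ η, K (ξ - η)) + ENNReal.ofReal (17 * s) *
        (A * ∫⁻ η, ENNReal.ofReal ((1 + ‖ξ - η‖ ^ 2) ^ (m + 1))⁻¹ * T η)) := by
        rw [lintegral_const_mul _ (by fun_prop), lintegral_add_left (by fun_prop),
          lintegral_const_mul _ (by fun_prop), lintegral_const_mul _ (by fun_prop),
          lintegral_const_mul _ (by fun_prop)]
    _ ≤ 2 * (ENNReal.ofReal (34 * s) * (∫⁻ ζ, K ζ) + ENNReal.ofReal (17 * s) * (A * (m *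
        (((∫⁻ t, truncInvSqrt t) + ∫⁻ t : ℝ, ENNReal.ofReal (1 + t ^ 2)⁻¹) ^ m *
        ((ENNReal.ofReal (2 * ((m : ℝ) + 1))⁻¹)⁻¹ * ∫⁻ t, truncInvSqrt t))))) := by
        rw [lintegral_sub_left_eq_self K ξ]
        gcongr
        exact lintegral_decay_mul_truncInvSqrt_le hs h₁ h₂ h₁₂ ξ
    _ = _ := by
        rw [ENNReal.ofReal_mul (by norm_num), ENNReal.ofReal_mul (by norm_num),
          ENNReal.ofReal_ofNat, ENNReal.ofReal_ofNat]
        ring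

lemma sq_lintegral_mul_le {α : Type*} [MeasurableSpace α] {μ : Measure α} {k w f : α → ℝ≥0∞}
    (hk : Measurable k) (hw : Measurable w) (hf : Measurable f) (hw0 : ∀ᵐ x ∂μ, w x ≠ 0)
    (hwt : ∀ x, w x ≠ ∞) :
    (∫⁻ x, k x * f x ∂μ) ^ 2 ≤ (∫⁻ x, k x / w x ∂μ) * ∫⁻ x, k x * (w x * f x ^ 2) ∂μ := by
  have hsq : ∀ y : ℝ≥0∞, (y ^ (1 / 2 : ℝ)) ^ (2 : ℝ) = y := fun y => by
    rw [← ENNReal.rpow_mul]; norm_num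
  have h := ENNReal.lintegral_mul_le_Lp_mul_Lq μ Real.HolderConjugate.two_two
    (f := fun x => (k x / w x) ^ (1 / 2 : ℝ)) (g := fun x => (k x * (w x * f x ^ 2)) ^ (1 / 2 : ℝ))
    (by fun_prop) (by fun_prop)
  simp only [hsq, Pi.mul_apply] at h
  have heq : ∫⁻ x, k x * f x ∂μ
      = ∫⁻ x, (k x / w x) ^ (1 / 2 : ℝ) * (k x * (w x * f x ^ 2)) ^ (1 / 2 : ℝ) ∂μ := by
    refine lintegral_congr_ae ?_
    filter_upwards [hw0] with x hx
    rw [← ENNReal.mul_rpow_of_nonneg _ _ (by norm_num)]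
    have : k x / w x * (k x * (w x * f x ^ 2)) = (k x * f x) ^ (2 : ℝ) := by
      rw [ENNReal.rpow_two, div_eq_mul_inv]
      calc _ = (w x * (w x)⁻¹) * (k x * f x) ^ 2 := by ring
        _ = _ := by rw [ENNReal.mul_inv_cancel hx (hwt x), one_mul]
    rw [this, ← ENNReal.rpow_mul]
    norm_num
  rw [heq]
  refine (pow_le_pow_left' h 2).trans_eq ?_
  rw [mul_pow, ← ENNReal.rpow_two, ← ENNReal.rpow_two, hsq, hsq]

/-- Weighted `L²` bound for convolution with the kernel `k`. -/
lemma lintegral_mul_sq_lintegral_le {E : Type*} [NormedAddCommGroup E] [MeasurableSpace E]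
    [BorelSpace E] [SecondCountableTopology E] {μ : Measure E} [SFinite μ]
    [μ.IsAddRightInvariant] {k v w f : E → ℝ≥0∞}
    (hk : Measurable k) (hw : Measurable w) (hf : Measurable f)
    (hw0 : ∀ᵐ x ∂μ, w x ≠ 0) (hwt : ∀ x, w x ≠ ∞) {D : ℝ≥0∞}
    (hD : ∀ ξ, v ξ * ∫⁻ η, k (ξ - η) / w η ∂μ ≤ D) :
    ∫⁻ ξ, v ξ * (∫⁻ η, k (ξ - η) * f η ∂μ) ^ 2 ∂μ
      ≤ D * ((∫⁻ ζ, k ζ ∂μ) * ∫⁻ η, w η * f η ^ 2 ∂μ) := by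
  calc _ ≤ ∫⁻ ξ, D * ∫⁻ η, k (ξ - η) * (w η * f η ^ 2) ∂μ ∂μ := by
        refine lintegral_mono fun ξ => ?_
        dsimp only
        refine le_trans (mul_le_mul_right (sq_lintegral_mul_le (k := fun η => k (ξ - η))
          (by fun_prop) hw hf hw0 hwt) _) ?_
        rw [← mul_assoc]
        gcongr
        exact hD ξ
    _ = D * ∫⁻ ξ, ∫⁻ η, k (ξ - η) * (w η * f η ^ 2) ∂μ ∂μ := by
        rw [lintegral_const_mul]
        exact Measurable.lintegral_prod_right' (f := fun z : E × E =>
          k (z.1 - z.2) * (w z.2 * f z.2 ^ 2)) (by fun_prop)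
    _ = D * ∫⁻ η, ∫⁻ ξ, k (ξ - η) * (w η * f η ^ 2) ∂μ ∂μ := by
        rw [lintegral_lintegral_swap]
        exact Measurable.aemeasurable (by fun_prop)
    _ = D * ∫⁻ η, (∫⁻ ζ, k ζ ∂μ) * (w η * f η ^ 2) ∂μ := by
        congr 1
        refine lintegral_congr fun η => ?_
        rw [lintegral_mul_const _ (by fun_prop), lintegral_sub_right_eq_self k η]
    _ = _ := by rw [lintegral_const_mul _ (by fun_prop)]

lemma ae_pAbs_pos {n : ℕ} {s : ℝ} (hs : 0 < s) {e₁ : EuclideanSpace ℝ (Fin n)}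
    (h₁ : ‖e₁‖ = 1) (e₂ : EuclideanSpace ℝ (Fin n)) : ∀ᵐ η, 0 < pAbs s e₁ e₂ η := by
  have hne : (LinearMap.ker (innerSL ℝ e₁).toLinearMap) ≠ ⊤ := by
    intro h
    have : e₁ ∈ LinearMap.ker (innerSL ℝ e₁).toLinearMap := h ▸ Submodule.mem_top
    simp at this
    simp [this] at h₁
  have h := Measure.addHaar_submodule volume _ hne
  rw [measure_eq_zero_iff_ae_notMem] at h
  filter_upwards [h] with η hη
  have hin : ⟪e₁, η⟫ ≠ 0 := by simpa using hη
  rw [pAbs]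
  positivity

lemma enorm_fourier_mul_le {n : ℕ} (Φ u : SchwartzMap (EuclideanSpace ℝ (Fin n)) ℂ)
    (ξ : EuclideanSpace ℝ (Fin n)) :
    ‖𝓕 (fun x => Φ x * u x) ξ‖ₑ ≤ ∫⁻ η, ‖𝓕 (⇑Φ) (ξ - η)‖ₑ * ‖𝓕 (⇑u) η‖ₑ := by
  have h1 : SchwartzMap.convolution (ContinuousLinearMap.mul ℂ ℂ) (𝓕⁻ Φ) (𝓕⁻ u)
      = 𝓕⁻ (SchwartzMap.pairing (ContinuousLinearMap.mul ℂ ℂ) Φ u) := by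
    simp [SchwartzMap.convolution]
  have h2 := congrArg (fun f : SchwartzMap (EuclideanSpace ℝ (Fin n)) ℂ => f (-ξ)) h1
  simp only [SchwartzMap.convolution_apply, SchwartzMap.fourierInv_coe] at h2
  have h3 : 𝓕 (fun x => Φ x * u x) ξ =
      ∫ t, 𝓕⁻ (⇑Φ) t * 𝓕⁻ (⇑u) (-ξ - t) := by
    have h4 : 𝓕⁻ (⇑(SchwartzMap.pairing (ContinuousLinearMap.mul ℂ ℂ) Φ u)) (-ξ)
        = 𝓕 (fun x => Φ x * u x) ξ := by
      rw [Real.fourierInv_eq_fourier_neg, neg_neg]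
      rfl
    rw [← h4, ← h2]
    rfl
  rw [h3]
  refine (enorm_integral_le_lintegral_enorm _).trans_eq ?_
  rw [← lintegral_sub_left_eq_self _ (-ξ)]
  rw [← lintegral_neg_eq_self]
  refine lintegral_congr fun η => ?_
  rw [enorm_mul, Real.fourierInv_eq_fourier_neg, Real.fourierInv_eq_fourier_neg]
  congr 3 <;> abel_nf

lemma SchwartzMap.exists_decay {n : ℕ} (f : SchwartzMap (EuclideanSpace ℝ (Fin n)) ℂ) (N : ℕ) :
    ∃ A : ℝ, ∀ ζ, ‖f ζ‖ * (1 + ‖ζ‖ ^ 2) ≤ A * ((1 + ‖ζ‖ ^ 2) ^ N)⁻¹ := by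
  refine ⟨2 ^ (2 * (N + 1)) * (Finset.Iic (2 * (N + 1), 0)).sup
    (fun m => SchwartzMap.seminorm ℝ m.1 m.2) f, fun ζ => ?_⟩
  rw [← div_eq_mul_inv, le_div_iff₀ (by positivity)]
  have h := SchwartzMap.one_add_le_sup_seminorm_apply (𝕜 := ℝ) (m := (2 * (N + 1), 0))
    (k := 2 * (N + 1)) (n := 0) le_rfl le_rfl f ζ
  rw [norm_iteratedFDeriv_zero] at h
  refine le_trans ?_ h
  rw [mul_assoc, ← pow_succ', mul_comm, pow_mul]
  gcongr
  nlinarith [norm_nonneg ζ]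

lemma lintegral_enorm_mul_lt_top {n : ℕ} (f : SchwartzMap (EuclideanSpace ℝ (Fin n)) ℂ) :
    ∫⁻ ζ, ‖f ζ‖ₑ * ENNReal.ofReal (1 + ‖ζ‖ ^ 2) < ∞ := by
  have h := ((f.integrable (μ := volume)).norm.add (f.integrable_pow_mul volume 2)).2
  refine lt_of_eq_of_lt (lintegral_congr fun ζ => ?_) h
  rw [← ofReal_norm, ← ENNReal.ofReal_mul (norm_nonneg _), Pi.add_apply,
    Real.enorm_of_nonneg (by positivity)]
  congr 1
  ring

lemma integrable_pAbs_mul {n : ℕ} (s : ℝ) (e₁ e₂ : EuclideanSpace ℝ (Fin n))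
    (f : SchwartzMap (EuclideanSpace ℝ (Fin n)) ℂ) :
    Integrable fun ξ => pAbs s e₁ e₂ ξ * ‖f ξ‖ ^ 2 := by
  obtain ⟨A, hA⟩ := SchwartzMap.exists_decay f 0
  set M : ℝ := 1 + 2 * |s| * ‖e₂‖ + 2 * |s| * ‖e₁‖ with hM
  have hint := ((f.integrable (μ := volume)).norm).const_mul (M * A)
  have hc : Continuous fun ξ => pAbs s e₁ e₂ ξ := by unfold pAbs; fun_prop
  refine hint.mono' (by fun_prop) (Filter.Eventually.of_forall fun ξ => ?_)
  have h1 : |⟪e₁, ξ⟫| ≤ ‖e₁‖ * ‖ξ‖ := abs_real_inner_le_norm _ _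
  have h2 : |⟪e₂, ξ⟫| ≤ ‖e₂‖ * ‖ξ‖ := abs_real_inner_le_norm _ _
  have hp : pAbs s e₁ e₂ ξ ≤ M * (1 + ‖ξ‖ ^ 2) := by
    have h3 : pAbs s e₁ e₂ ξ ≤ |‖ξ‖ ^ 2 - 2 * s * ⟪e₂, ξ⟫| + |2 * s * ⟪e₁, ξ⟫| := by
      refine Real.sqrt_le_iff.2 ⟨by positivity, ?_⟩
      rw [add_sq, sq_abs, sq_abs]
      nlinarith [mul_nonneg (abs_nonneg (‖ξ‖ ^ 2 - 2 * s * ⟪e₂, ξ⟫))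
        (abs_nonneg (2 * s * ⟪e₁, ξ⟫))]
    have h4 : |‖ξ‖ ^ 2 - 2 * s * ⟪e₂, ξ⟫| ≤ ‖ξ‖ ^ 2 + 2 * |s| * (‖e₂‖ * ‖ξ‖) := by
      refine (abs_sub _ _).trans ?_
      rw [abs_mul, abs_mul, abs_two, abs_of_nonneg (sq_nonneg ‖ξ‖)]
      gcongr
    have h5 : |2 * s * ⟪e₁, ξ⟫| ≤ 2 * |s| * (‖e₁‖ * ‖ξ‖) := by
      rw [abs_mul, abs_mul, abs_two]
      gcongr
    have h6 : ‖ξ‖ ≤ 1 + ‖ξ‖ ^ 2 := by nlinarith [sq_nonneg (‖ξ‖ - 1)]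
    have h7 : 0 ≤ 2 * |s| * ‖e₂‖ := by positivity
    have h8 : 0 ≤ 2 * |s| * ‖e₁‖ := by positivity
    rw [hM]
    nlinarith [mul_le_mul_of_nonneg_left h6 h7, mul_le_mul_of_nonneg_left h6 h8]
  have hp0 : 0 ≤ pAbs s e₁ e₂ ξ := Real.sqrt_nonneg _
  rw [Real.norm_of_nonneg (by positivity)]
  have hA' := hA ξ
  rw [pow_zero, inv_one, mul_one] at hA'
  calc _ ≤ M * (1 + ‖ξ‖ ^ 2) * ‖f ξ‖ ^ 2 := by gcongr
    _ = M * (‖f ξ‖ * (1 + ‖ξ‖ ^ 2)) * ‖f ξ‖ := by ring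
    _ ≤ M * A * ‖f ξ‖ := by gcongr

end

theorem stmt_11 (n : ℕ) (hn : 2 ≤ n)
    (Φ : SchwartzMap (EuclideanSpace ℝ (Fin n)) ℂ) :
    ∃ C > 0, ∀ s ≥ (1 : ℝ), ∀ e₁ e₂ : EuclideanSpace ℝ (Fin n),
      ‖e₁‖ = 1 → ‖e₂‖ = 1 → ⟪e₁, e₂⟫ = 0 →
      ∀ u : SchwartzMap (EuclideanSpace ℝ (Fin n)) ℂ,
        ∫ ξ, (1 + ‖ξ‖ ^ 2) * ‖𝓕 (fun x => Φ x * u x) ξ‖ ^ 2 ≤ C * s * ∫ ξ, pAbs s e₁ e₂ ξ * ‖𝓕 (⇑u) ξ‖ ^ 2 := by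
  obtain ⟨m, rfl⟩ : ∃ m, n = m + 1 := ⟨n - 1, by omega⟩
  obtain ⟨A, hA⟩ := SchwartzMap.exists_decay (𝓕 Φ) (m + 1)
  have hmΦ : Measurable fun ζ => ‖𝓕 (⇑Φ) ζ‖ₑ := (𝓕 Φ).continuous.measurable.enorm
  have hAΦ : ∀ ζ, ‖𝓕 (⇑Φ) ζ‖ₑ * ENNReal.ofReal (1 + ‖ζ‖ ^ 2) ≤
      ENNReal.ofReal A * ENNReal.ofReal ((1 + ‖ζ‖ ^ 2) ^ (m + 1))⁻¹ := fun ζ => by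
    rw [← ofReal_norm, ← ENNReal.ofReal_mul (norm_nonneg _),
      ← ENNReal.ofReal_mul' (by positivity)]
    exact ENNReal.ofReal_le_ofReal (hA ζ)
  have hKtop : ∫⁻ ζ, ‖𝓕 (⇑Φ) ζ‖ₑ * ENNReal.ofReal (1 + ‖ζ‖ ^ 2) ≠ ⊤ :=
    (lintegral_enorm_mul_lt_top (𝓕 Φ)).ne
  set D := (2 * (34 * (∫⁻ ζ, ‖𝓕 (⇑Φ) ζ‖ₑ * ENNReal.ofReal (1 + ‖ζ‖ ^ 2)) +
    17 * (ENNReal.ofReal A * (m *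
        (((∫⁻ t, truncInvSqrt t) + ∫⁻ t : ℝ, ENNReal.ofReal (1 + t ^ 2)⁻¹) ^ m *
        ((ENNReal.ofReal (2 * ((m : ℝ) + 1))⁻¹)⁻¹ * ∫⁻ t, truncInvSqrt t)))))) with hD
  have hDtop : D ≠ ⊤ := by
    have h1 := lintegral_truncInvSqrt_lt_top.ne
    have h2 := lintegral_wt_lt_top.ne
    have h3 : (ENNReal.ofReal (2 * ((m : ℝ) + 1))⁻¹)⁻¹ ≠ ⊤ :=
      ENNReal.inv_ne_top.2 (ENNReal.ofReal_pos.2 (by positivity)).ne'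
    have h4 : ((∫⁻ t, truncInvSqrt t) + ∫⁻ t : ℝ, ENNReal.ofReal (1 + t ^ 2)⁻¹) ^ m ≠ ⊤ :=
      ENNReal.pow_ne_top (ENNReal.add_ne_top.2 ⟨h1, h2⟩)
    refine ENNReal.mul_ne_top (by simp) (ENNReal.add_ne_top.2
      ⟨ENNReal.mul_ne_top (by simp) hKtop, ENNReal.mul_ne_top (by simp) ?_⟩)
    exact ENNReal.mul_ne_top (by simp) (ENNReal.mul_ne_top (by simp)
      (ENNReal.mul_ne_top h4 (ENNReal.mul_ne_top h3 h1)))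
  set L := ∫⁻ ζ, ‖𝓕 (⇑Φ) ζ‖ₑ with hL
  have hLtop : L ≠ ⊤ := ((𝓕 Φ).integrable (μ := volume)).2.ne
  refine ⟨(D * L).toReal + 1, by positivity, fun s hs e₁ e₂ h₁ h₂ h₁₂ u => ?_⟩
  have hp0 : ∀ ξ, 0 ≤ pAbs s e₁ e₂ ξ := fun ξ => Real.sqrt_nonneg _
  have hint : Integrable fun ξ => pAbs s e₁ e₂ ξ * ‖𝓕 (⇑u) ξ‖ ^ 2 :=
    integrable_pAbs_mul s e₁ e₂ (𝓕 u)
  have hRnn : 0 ≤ ∫ ξ, pAbs s e₁ e₂ ξ * ‖𝓕 (⇑u) ξ‖ ^ 2 :=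
    integral_nonneg fun ξ => mul_nonneg (hp0 ξ) (by positivity)
  have hR : ∫⁻ ξ, ENNReal.ofReal (pAbs s e₁ e₂ ξ) * ‖𝓕 (⇑u) ξ‖ₑ ^ 2
      = ENNReal.ofReal (∫ ξ, pAbs s e₁ e₂ ξ * ‖𝓕 (⇑u) ξ‖ ^ 2) := by
    rw [ofReal_integral_eq_lintegral_ofReal hint
      (Filter.Eventually.of_forall fun ξ => mul_nonneg (hp0 ξ) (by positivity))]
    refine lintegral_congr fun ξ => ?_
    rw [ENNReal.ofReal_mul (hp0 ξ), ENNReal.ofReal_pow (norm_nonneg _), ofReal_norm]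
  have hpm : Measurable fun η => pAbs s e₁ e₂ η := by unfold pAbs; fun_prop
  have hbound : ∫⁻ ξ, ENNReal.ofReal ((1 + ‖ξ‖ ^ 2) * ‖𝓕 (fun x => Φ x * u x) ξ‖ ^ 2)
      ≤ ENNReal.ofReal (((D * L).toReal + 1) * s *
        ∫ ξ, pAbs s e₁ e₂ ξ * ‖𝓕 (⇑u) ξ‖ ^ 2) := by
    calc _ ≤ ∫⁻ ξ, ENNReal.ofReal (1 + ‖ξ‖ ^ 2) *
          (∫⁻ η, ‖𝓕 (⇑Φ) (ξ - η)‖ₑ * ‖𝓕 (⇑u) η‖ₑ) ^ 2 := by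
          refine lintegral_mono fun ξ => ?_
          rw [ENNReal.ofReal_mul (by positivity), ENNReal.ofReal_pow (norm_nonneg _),
            ofReal_norm]
          gcongr
          exact enorm_fourier_mul_le Φ u ξ
      _ ≤ D * ENNReal.ofReal s *
          (L * ∫⁻ η, ENNReal.ofReal (pAbs s e₁ e₂ η) * ‖𝓕 (⇑u) η‖ₑ ^ 2) := by
          refine lintegral_mul_sq_lintegral_le hmΦ (by fun_prop)
            (𝓕 u).continuous.measurable.enorm ?_ (fun _ => ENNReal.ofReal_ne_top)
            (lintegral_kernel_div_pAbs_le hs h₁ h₂ h₁₂ hmΦ hAΦ)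
          filter_upwards [ae_pAbs_pos (s := s) (by linarith) h₁ e₂] with η hη
          exact (ENNReal.ofReal_pos.2 hη).ne'
      _ = ENNReal.ofReal ((D * L).toReal * s *
          ∫ ξ, pAbs s e₁ e₂ ξ * ‖𝓕 (⇑u) ξ‖ ^ 2) := by
          rw [hR, ENNReal.ofReal_mul (by positivity), ENNReal.ofReal_mul (by positivity),
            ENNReal.ofReal_toReal (ENNReal.mul_ne_top hDtop hLtop)]
          ring
      _ ≤ _ := by
          refine ENNReal.ofReal_le_ofReal ?_
          exact mul_le_mul_of_nonneg_right
            (mul_le_mul_of_nonneg_right (by linarith) (by linarith)) hRnn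
  by_cases hI : Integrable fun ξ => (1 + ‖ξ‖ ^ 2) * ‖𝓕 (fun x => Φ x * u x) ξ‖ ^ 2
  · rw [← ofReal_integral_eq_lintegral_ofReal hI
      (Filter.Eventually.of_forall fun ξ => by positivity)] at hbound
    exact (ENNReal.ofReal_le_ofReal_iff (by positivity)).1 hbound
  · rw [integral_undef hI]
    positivity
end
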